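/- arXiv:1907.08552 — 9 statements merged into one kernel-verified Lean document; each statement's English description precedes it below -/
import Mathlib

section
/- Let ν be a real number with 0 < ν ≤ 1/3. Then the polynomial C has precisely two real roots and precisely two purely imaginary roots; that is, the set {α ∈ ℂ : C(α) = 0 and Im α = 0} has exactly two elements, and the set {α ∈ ℂ : C(α) = 0 and Re α = 0} has exactly two elements. -/
/-- The octic polynomial `C(α) = α^8 − 6(3ν²+1)α^4 + 8(1−9ν²)α² − 3(9ν⁴+6ν²+1)`,
regarded as a function of a complex variable. -/
noncomputable def Cfun (ν : ℝ) (α : ℂ) : ℂ :=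
  α ^ 8 - 6 * (3 * (ν : ℂ) ^ 2 + 1) * α ^ 4 + 8 * (1 - 9 * (ν : ℂ) ^ 2) * α ^ 2
    - 3 * (9 * (ν : ℂ) ^ 4 + 6 * (ν : ℂ) ^ 2 + 1)

/-- A quartic `y⁴ - 6sy² + 8cy - 3s²` with `1 < s ≤ 4/3` and `|c| ≤ 1` has exactly one positive
root. -/
theorem existsUnique_pos_root_quartic {s c : ℝ} (hs : 1 < s) (hs' : s ≤ 4 / 3)
    (hc : -1 ≤ c) (hc' : c ≤ 1) :
    ∃! y : ℝ, 0 < y ∧ y ^ 4 - 6 * s * y ^ 2 + 8 * c * y - 3 * s ^ 2 = 0 := by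
  have hex : ∃ y : ℝ, 0 < y ∧ y ^ 4 - 6 * s * y ^ 2 + 8 * c * y - 3 * s ^ 2 = 0 := by
    have hcont : ContinuousOn (fun y : ℝ => y ^ 4 - 6 * s * y ^ 2 + 8 * c * y - 3 * s ^ 2)
        (Set.Icc 0 4) := by fun_prop
    obtain ⟨y, hy, hy0⟩ := intermediate_value_Icc (by norm_num : (0 : ℝ) ≤ 4) hcont
      (show (0 : ℝ) ∈ _ from ⟨by nlinarith, by nlinarith⟩)
    refine ⟨y, lt_of_le_of_ne hy.1 ?_, hy0⟩
    rintro rfl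
    simp only at hy0
    nlinarith
  obtain ⟨a, ha, ha0⟩ := hex
  refine ⟨a, ⟨ha, ha0⟩, ?_⟩
  rintro b ⟨hb, hb0⟩
  have hprod : (b - a) * ((a + b) * ((a * b) ^ 2 + 3 * s ^ 2) - 8 * c * (a * b)) = 0 := by
    linear_combination a ^ 2 * hb0 - b ^ 2 * ha0
  have hpos : 0 < (a + b) * ((a * b) ^ 2 + 3 * s ^ 2) - 8 * c * (a * b) := by
    obtain ⟨m, hm, hm2⟩ : ∃ m : ℝ, 0 < m ∧ m ^ 2 = a * b :=
      ⟨√(a * b), Real.sqrt_pos.2 (mul_pos ha hb), Real.sq_sqrt (mul_pos ha hb).le⟩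
    have hsum : 2 * m ≤ a + b := by
      refine (sq_le_sq₀ (by positivity) (by positivity)).1 ?_
      nlinarith [sq_nonneg (a - b)]
    have hquart : 4 * c * m < m ^ 4 + 3 * s ^ 2 := by
      nlinarith [sq_nonneg (m ^ 2 - 1), sq_nonneg (m - 1)]
    rw [← hm2]
    nlinarith [mul_le_mul_of_nonneg_right hsum (by positivity : 0 ≤ (m ^ 2) ^ 2 + 3 * s ^ 2),
      mul_pos hm (sub_pos.2 hquart)]
  have := (mul_eq_zero.1 hprod).resolve_right hpos.ne'
  linarith

/-- If `P` has exactly one positive solution and no solution at `0`, then exactly two real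
multiples `x • w` of a nonzero `w` satisfy `P (x ^ 2)`. -/
theorem ncard_mul_of_existsUnique_pos {P : ℝ → Prop} (hP : ∃! y, 0 < y ∧ P y) (h0 : ¬ P 0)
    {w : ℂ} (hw : w ≠ 0) : {α : ℂ | ∃ x : ℝ, α = x * w ∧ P (x ^ 2)}.ncard = 2 := by
  obtain ⟨y, ⟨hy, hPy⟩, huniq⟩ := hP
  have hr : 0 < √y := Real.sqrt_pos.2 hy
  have hr2 : √y ^ 2 = y := Real.sq_sqrt hy.le
  rw [Set.ncard_eq_two]
  refine ⟨(√y : ℝ) * w, (-√y : ℝ) * w, ?_, ?_⟩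
  · intro h
    have := Complex.ofReal_injective (mul_right_cancel₀ hw h)
    linarith
  · ext α
    simp only [Set.mem_ofPred_eq, Set.mem_insert_iff, Set.mem_singleton_iff]
    constructor
    · rintro ⟨x, rfl, hx⟩
      have hx0 : x ≠ 0 := by
        rintro rfl
        exact h0 (by simpa using hx)
      have hxy : x ^ 2 = √y ^ 2 := by rw [hr2, huniq _ ⟨by positivity, hx⟩]
      rcases sq_eq_sq_iff_eq_or_eq_neg.1 hxy with h | h
      · exact Or.inl (by rw [h])
      · exact Or.inr (by rw [h])
    · rintro (rfl | rfl)
      · exact ⟨√y, rfl, by rwa [hr2]⟩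
      · exact ⟨-√y, rfl, by rwa [neg_sq, hr2]⟩

theorem Cfun_ofReal (ν x : ℝ) : Cfun ν x = 0 ↔
    (x ^ 2) ^ 4 - 6 * (1 + 3 * ν ^ 2) * (x ^ 2) ^ 2 + 8 * (1 - 9 * ν ^ 2) * x ^ 2
      - 3 * (1 + 3 * ν ^ 2) ^ 2 = 0 := by
  rw [← Complex.ofReal_eq_zero, Cfun]
  push_cast
  ring_nf

theorem Cfun_ofReal_mul_I (ν x : ℝ) : Cfun ν (x * Complex.I) = 0 ↔
    (x ^ 2) ^ 4 - 6 * (1 + 3 * ν ^ 2) * (x ^ 2) ^ 2 + 8 * (-(1 - 9 * ν ^ 2)) * x ^ 2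
      - 3 * (1 + 3 * ν ^ 2) ^ 2 = 0 := by
  have h2 : ((x : ℂ) * Complex.I) ^ 2 = -(x : ℂ) ^ 2 := by
    rw [mul_pow, Complex.I_sq]; ring
  have h4 : ((x : ℂ) * Complex.I) ^ 4 = (x : ℂ) ^ 4 := by
    rw [mul_pow, Complex.I_pow_four, mul_one]
  have h8 : ((x : ℂ) * Complex.I) ^ 8 = (x : ℂ) ^ 8 := by
    rw [show 8 = 4 * 2 from rfl, pow_mul, h4, ← pow_mul]
  rw [← Complex.ofReal_eq_zero, Cfun, h2, h4, h8]
  push_cast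
  ring_nf

/-- For `0 < ν ≤ 1/3`, the polynomial `C` has precisely two real roots and precisely two
purely imaginary roots. -/
theorem stmt_0 (ν : ℝ) (hν0 : 0 < ν) (hν1 : ν ≤ 1 / 3) :
    {α : ℂ | Cfun ν α = 0 ∧ α.im = 0}.ncard = 2 ∧
    {α : ℂ | Cfun ν α = 0 ∧ α.re = 0}.ncard = 2 := by
  have hs : 1 < 1 + 3 * ν ^ 2 := by nlinarith
  have hs' : 1 + 3 * ν ^ 2 ≤ 4 / 3 := by nlinarith
  constructor
  · rw [← ncard_mul_of_existsUnique_pos (existsUnique_pos_root_quartic hs hs'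
      (c := 1 - 9 * ν ^ 2) (by linarith) (by linarith)) (by nlinarith) one_ne_zero]
    congr 1
    ext α
    simp only [Set.mem_ofPred_eq, mul_one]
    constructor
    · rintro ⟨h, him⟩
      have hα : α = (α.re : ℂ) := Complex.ext (by simp) (by simpa using him)
      exact ⟨α.re, hα, (Cfun_ofReal ν _).1 (hα ▸ h)⟩
    · rintro ⟨x, rfl, hx⟩
      exact ⟨(Cfun_ofReal ν x).2 hx, Complex.ofReal_im x⟩
  · rw [← ncard_mul_of_existsUnique_pos (existsUnique_pos_root_quartic hs hs'
      (c := -(1 - 9 * ν ^ 2)) (by linarith) (by linarith)) (by nlinarith) Complex.I_ne_zero]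
    congr 1
    ext α
    simp only [Set.mem_ofPred_eq]
    constructor
    · rintro ⟨h, hre⟩
      have hα : α = (α.im : ℂ) * Complex.I := Complex.ext (by simpa using hre) (by simp)
      exact ⟨α.im, hα, (Cfun_ofReal_mul_I ν _).1 (hα ▸ h)⟩
    · rintro ⟨x, rfl, hx⟩
      exact ⟨(Cfun_ofReal_mul_I ν x).2 hx, by simp⟩
end

section
/- Let ν be a real number with 0 < ν ≤ 1/3. Then the polynomial C has exactly one root α in the open first quadrant {α ∈ ℂ : Re α > 0 and Im α > 0}; consequently, by the symmetries C(−α) = C(α) and C(conj(α)) = conj(C(α)), C has exactly one root in each of the four open quadrants of the complex plane. -/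
open ComplexConjugate in
theorem Cfun_conj (ν : ℝ) (α : ℂ) : Cfun ν (conj α) = conj (Cfun ν α) := by
  simp [Cfun, map_ofNat]

theorem Cfun_neg (ν : ℝ) (α : ℂ) : Cfun ν (-α) = Cfun ν α := by
  simp only [Cfun]
  ring

/-- As a quartic in `α²`, the polynomial splits over the reals into one quadratic with positive
discriminant and one with negative discriminant. -/
theorem Cfun_factor (ν : ℝ) (hν0 : 0 < ν) (hν1 : ν ≤ 1 / 3) :
    ∃ a k d : ℝ, 0 < k ∧ 0 < d ∧
      ∀ α : ℂ, Cfun ν α = ((α ^ 2 + a) ^ 2 - k) * ((α ^ 2 - a) ^ 2 + d) := by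
  obtain ⟨p, hp⟩ : ∃ p, p = 3 * ν ^ 2 + 1 := ⟨_, rfl⟩
  obtain ⟨q, hq⟩ : ∃ q, q = 1 - 9 * ν ^ 2 := ⟨_, rfl⟩
  have hp1 : 1 < p := by rw [hp]; nlinarith
  have hq0 : 0 ≤ q := by rw [hq]; nlinarith
  have hq1 : q < 1 := by rw [hq]; nlinarith
  have hpq : 0 < p ^ 3 - q ^ 2 := by
    have h₁ : 1 < p ^ 3 := one_lt_pow₀ hp1 (by norm_num)
    have h₂ : q ^ 2 < 1 := pow_lt_one₀ hq0 hq1 (by norm_num)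
    linarith
  obtain ⟨t, ht0, ht⟩ : ∃ t : ℝ, 0 < t ∧ t ^ 3 = p ^ 3 - q ^ 2 :=
    ⟨(p ^ 3 - q ^ 2) ^ (((3 : ℕ) : ℝ)⁻¹), Real.rpow_pos_of_pos hpq _,
      Real.rpow_inv_natCast_pow hpq.le (by norm_num)⟩
  have htp : t ≤ p := by
    refine le_of_pow_le_pow_left₀ (n := 3) (by norm_num) (by linarith) ?_
    rw [ht]
    linarith [sq_nonneg q]
  have hrad : 0 ≤ p ^ 2 + p * t + t ^ 2 := by positivity
  obtain ⟨a, ha0, ha⟩ : ∃ a : ℝ, 0 ≤ a ∧ a ^ 2 = p - t :=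
    ⟨√(p - t), Real.sqrt_nonneg _, Real.sq_sqrt (by linarith)⟩
  obtain ⟨r, hr0, hr⟩ : ∃ r : ℝ, 0 ≤ r ∧ r ^ 2 = p ^ 2 + p * t + t ^ 2 :=
    ⟨√(p ^ 2 + p * t + t ^ 2), Real.sqrt_nonneg _, Real.sq_sqrt hrad⟩
  have har : a * r = q := by
    refine (sq_eq_sq₀ (mul_nonneg ha0 hr0) hq0).1 ?_
    rw [mul_pow, ha, hr]
    linear_combination -ht
  refine ⟨a, 2 * p + t + 2 * r, 2 * r - 2 * p - t, by linarith, ?_, fun α => ?_⟩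
  · have : 2 * p + t < 2 * r := by
      refine lt_of_pow_lt_pow_left₀ 2 (by linarith) ?_
      nlinarith
    linarith
  · have ha' : (a : ℂ) ^ 2 = p - t := by exact_mod_cast ha
    have hr' : (r : ℂ) ^ 2 = p ^ 2 + p * t + t ^ 2 := by exact_mod_cast hr
    have har' : (a : ℂ) * r = q := by exact_mod_cast har
    have hp' : (p : ℂ) = 3 * ν ^ 2 + 1 := by exact_mod_cast hp
    have hq' : (q : ℂ) = 1 - 9 * ν ^ 2 := by exact_mod_cast hq
    have key : Cfun ν α = α ^ 8 - 6 * p * α ^ 4 + 8 * q * α ^ 2 - 3 * p ^ 2 := by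
      rw [Cfun, hp', hq']
      ring
    rw [key]
    push_cast
    linear_combination (2 * α ^ 4 - a ^ 2 + 3 * p + 3 * t) * ha' + 4 * hr' - 8 * α ^ 2 * har'

/-- The polynomial has exactly one root in the open first quadrant. -/
theorem Cfun_existsUnique_root (ν : ℝ) (hν0 : 0 < ν) (hν1 : ν ≤ 1 / 3) :
    ∃ β : ℂ, ∀ α : ℂ, (Cfun ν α = 0 ∧ 0 < α.re ∧ 0 < α.im) ↔ α = β := by
  obtain ⟨a, k, d, hk, hd, hC⟩ := Cfun_factor ν hν0 hν1
  have hs : 0 < √d := Real.sqrt_pos.2 hd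
  have hsd : ((√d : ℝ) : ℂ) ^ 2 = d := by exact_mod_cast Real.sq_sqrt hd.le
  have hsk : ((√k : ℝ) : ℂ) ^ 2 = k := by exact_mod_cast Real.sq_sqrt hk.le
  have im_sq (α : ℂ) : (α ^ 2).im = 2 * (α.re * α.im) := by
    rw [sq, Complex.mul_im]
    ring
  have root_iff (α : ℂ) (hα : 0 < α.re * α.im) :
      Cfun ν α = 0 ↔ α ^ 2 = a + √d * Complex.I := by
    have him : 0 < (α ^ 2).im := by rw [im_sq]; linarith
    constructor
    · intro h
      have h₁ : (α ^ 2 + a - √k) * (α ^ 2 + a + √k) *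
          ((α ^ 2 - (a + √d * Complex.I)) * (α ^ 2 - (a - √d * Complex.I))) = 0 := by
        rw [← h, hC]
        linear_combination (-((α ^ 2 - a) ^ 2 - √d ^ 2 * Complex.I ^ 2)) * hsk
          + ((α ^ 2 + a) ^ 2 - k) * hsd
          - ((α ^ 2 + a) ^ 2 - k) * √d ^ 2 * Complex.I_sq
      rcases mul_eq_zero.1 h₁ with h₂ | h₂ <;> rcases mul_eq_zero.1 h₂ with h₃ | h₃
      · have := congrArg Complex.im h₃
        simp only [Complex.sub_im, Complex.add_im, Complex.ofReal_im, Complex.zero_im] at this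
        linarith
      · have := congrArg Complex.im h₃
        simp only [Complex.add_im, Complex.ofReal_im, Complex.zero_im] at this
        linarith
      · exact sub_eq_zero.1 h₃
      · have := congrArg Complex.im h₃
        simp only [Complex.sub_im, Complex.ofReal_im, Complex.zero_im, Complex.im_ofReal_mul,
          Complex.I_im] at this
        linarith
    · intro h
      rw [hC, h]
      linear_combination ((a + √d * Complex.I + a) ^ 2 - k) *
        (√d ^ 2 * Complex.I_sq - hsd)
  obtain ⟨γ, hγ⟩ := IsAlgClosed.exists_pow_nat_eq (a + √d * Complex.I : ℂ) two_pos
  have hγim : 0 < γ.re * γ.im := by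
    have h₁ : (γ ^ 2).im = √d := by rw [hγ]; simp
    rw [im_sq] at h₁
    linarith
  obtain ⟨β, hβ, hβre, hβim⟩ : ∃ β : ℂ, β ^ 2 = a + √d * Complex.I ∧ 0 < β.re ∧ 0 < β.im := by
    rcases pos_and_pos_or_neg_and_neg_of_mul_pos hγim with h | h
    · exact ⟨γ, hγ, h⟩
    · exact ⟨-γ, by rw [neg_sq, hγ], by simpa using h⟩
  refine ⟨β, fun α => ⟨fun ⟨h, hre, him⟩ => ?_, ?_⟩⟩
  · rw [root_iff α (mul_pos hre him), ← hβ, sq_eq_sq_iff_eq_or_eq_neg] at h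
    refine h.resolve_right fun h' => ?_
    rw [h', Complex.neg_re] at hre
    linarith
  · rintro rfl
    exact ⟨(root_iff _ (mul_pos hβre hβim)).2 hβ, hβre, hβim⟩

theorem conj_eq_iff_eq_conj (α β : ℂ) : starRingEnd ℂ α = β ↔ α = starRingEnd ℂ β :=
  star_eq_iff_star_eq.trans eq_comm

/-- For `0 < ν ≤ 1/3`, the polynomial `C` has exactly one root in the open first quadrant,
and consequently (by its symmetries) exactly one root in each of the four open quadrants. -/
theorem stmt_2 (ν : ℝ) (hν0 : 0 < ν) (hν1 : ν ≤ 1 / 3) :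
    {α : ℂ | Cfun ν α = 0 ∧ 0 < α.re ∧ 0 < α.im}.ncard = 1 ∧
    {α : ℂ | Cfun ν α = 0 ∧ α.re < 0 ∧ 0 < α.im}.ncard = 1 ∧
    {α : ℂ | Cfun ν α = 0 ∧ α.re < 0 ∧ α.im < 0}.ncard = 1 ∧
    {α : ℂ | Cfun ν α = 0 ∧ 0 < α.re ∧ α.im < 0}.ncard = 1 := by
  obtain ⟨β, hβ⟩ := Cfun_existsUnique_root ν hν0 hν1
  have conj_zero (α : ℂ) : Cfun ν (starRingEnd ℂ α) = 0 ↔ Cfun ν α = 0 := by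
    rw [Cfun_conj, map_eq_zero]
  simp only [Set.ncard_eq_one]
  refine ⟨⟨β, ?_⟩, ⟨-starRingEnd ℂ β, ?_⟩, ⟨-β, ?_⟩, ⟨starRingEnd ℂ β, ?_⟩⟩ <;> ext α <;>
    simp only [Set.mem_ofPred_eq, Set.mem_singleton_iff]
  · exact hβ α
  · have h := hβ (-starRingEnd ℂ α)
    rw [Cfun_neg, conj_zero] at h
    simp only [Complex.neg_re, Complex.neg_im, Complex.conj_re, Complex.conj_im, neg_neg,
      Left.neg_pos_iff] at h
    rw [h, neg_eq_iff_eq_neg, conj_eq_iff_eq_conj, map_neg]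
  · have h := hβ (-α)
    rw [Cfun_neg] at h
    simp only [Complex.neg_re, Complex.neg_im, Left.neg_pos_iff] at h
    rw [h, neg_eq_iff_eq_neg]
  · have h := hβ (starRingEnd ℂ α)
    rw [conj_zero] at h
    simp only [Complex.conj_re, Complex.conj_im, Left.neg_pos_iff] at h
    rw [h, conj_eq_iff_eq_conj]
end

section
/- Let ν be a real number with 0 < ν ≤ 1/3 and let α, β, X, x₁ ∈ ℂ. If the polynomial identity P(λ) = (λ − X)³(λ − x₁) holds (as polynomials in λ), i.e. if the quartic P has a root of multiplicity at least three, then C(α) = 0, α ≠ 0, and β = −(α²(α² − 2) + 3ν² + 1)/(6α). -/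
/-- The quartic polynomial `P(λ) = λ⁴ + 2αλ³ + (α²−1)λ² − βλ + ν²/4`. -/
noncomputable def Pfun (ν α β lam : ℂ) : ℂ :=
  lam ^ 4 + 2 * α * lam ^ 3 + (α ^ 2 - 1) * lam ^ 2 - β * lam + ν ^ 2 / 4

/-- For real `0 < ν ≤ 1/3`, if the quartic `P` has a root of multiplicity at least three,
then `C(α) = 0`, `α ≠ 0`, and `β = −(α²(α²−2) + 3ν² + 1)/(6α)`. -/
theorem stmt_4 (ν : ℝ) (hν0 : 0 < ν) (hν1 : ν ≤ 1 / 3) (α β X₀ x₁ : ℂ)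
    (h : ∀ lam : ℂ, Pfun (ν : ℂ) α β lam = (lam - X₀) ^ 3 * (lam - x₁)) :
    Cfun ν α = 0 ∧ α ≠ 0 ∧
      β = -(α ^ 2 * (α ^ 2 - 2) + 3 * (ν : ℂ) ^ 2 + 1) / (6 * α) := by
  simp only [Pfun] at h
  have h0 := h 0
  have h1 := h 1
  have h2 := h (-1)
  have h3 := h 2
  have hx : x₁ = -2 * α - 3 * X₀ := by
    linear_combination (1 / 2) * h0 - (1 / 2) * h1 - (1 / 6) * h2 + (1 / 6) * h3
  subst hx
  have hq : α ^ 2 + 6 * α * X₀ + 6 * X₀ ^ 2 - 1 = 0 := by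
    linear_combination -h0 + (1 / 2) * h1 + (1 / 2) * h2
  have hb : β = -8 * X₀ ^ 3 - 6 * α * X₀ ^ 2 := by
    linear_combination -(1 / 2) * h1 + (1 / 2) * h2
  have hw : (ν : ℂ) ^ 2 = -8 * α * X₀ ^ 3 - 12 * X₀ ^ 4 := by
    linear_combination 4 * h0
  have hα : α ≠ 0 := by
    rintro rfl
    have hneg : (ν : ℂ) ^ 2 = -1 / 3 := by
      linear_combination hw - (2 * X₀ ^ 2 + 1 / 3) * hq
    have hre : ν ^ 2 = -1 / 3 := by exact_mod_cast hneg
    nlinarith [sq_nonneg ν]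
  refine ⟨?_, hα, ?_⟩
  · have h4 : (ν : ℂ) ^ 4 = (-8 * α * X₀ ^ 3 - 12 * X₀ ^ 4) ^ 2 := by
      rw [← hw]; ring
    rw [Cfun, h4, hw]
    linear_combination (α ^ 6 - 6 * α ^ 5 * X₀ + 30 * α ^ 4 * X₀ ^ 2 + α ^ 4 - 12 * α ^ 3 * X₀
      + 36 * α ^ 2 * X₀ ^ 4 + 96 * α ^ 2 * X₀ ^ 2 - 5 * α ^ 2 - 216 * α * X₀ ^ 5 + 72 * α * X₀ ^ 3
      + 18 * α * X₀ - 648 * X₀ ^ 6 - 108 * X₀ ^ 4 + 18 * X₀ ^ 2 + 3) * hq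
  · rw [eq_div_iff (by simpa using hα), hb, hw]
    linear_combination (α ^ 2 - 1 - 6 * α * X₀ - 6 * X₀ ^ 2) * hq
end

section
/- Let ν be a real number with 0 < ν ≤ 1/3 and let α, β ∈ ℂ satisfy C(α) = 0 and 6αβ = −(α²(α² − 2) + 3ν² + 1). Then α ≠ 0 and the quartic polynomial P has a root of multiplicity at least three; that is, there exist X, x₁ ∈ ℂ such that P(λ) = (λ − X)³(λ − x₁) as polynomials in λ. -/
/-- A depressed quartic `y⁴ + py² + qy + r` whose two invariants `12r + p²` and `8p³ + 27q²` vanish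
has a root of multiplicity at least three. -/
theorem exists_triple_root_of_depressed_quartic {K : Type*} [Field K] [CharZero K] {p q r : K}
    (hI : 12 * r + p ^ 2 = 0) (hJ : 8 * p ^ 3 + 27 * q ^ 2 = 0) :
    ∃ t : K, ∀ y : K, y ^ 4 + p * y ^ 2 + q * y + r = (y - t) ^ 3 * (y + 3 * t) := by
  obtain ⟨t, hp, hq⟩ : ∃ t : K, p = -6 * t ^ 2 ∧ q = 8 * t ^ 3 := by
    by_cases hp : p = 0
    · subst hp
      have hq : q = 0 := by simpa using hJ
      exact ⟨0, by simp, by simp [hq]⟩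
    · obtain ⟨t, ht⟩ : ∃ t : K, 4 * p * t = -3 * q := ⟨-3 * q / (4 * p), by field_simp⟩
      have hpt : p = -6 * t ^ 2 := by
        refine mul_left_cancel₀ (mul_ne_zero (by norm_num : (8 : K) ≠ 0) (pow_ne_zero 2 hp)) ?_
        linear_combination hJ + 3 * (4 * p * t - 3 * q) * ht
      refine ⟨t, hpt, ?_⟩
      linear_combination ht / 3 - 4 / 3 * t * hpt
  refine ⟨t, fun y => ?_⟩
  subst hp hq
  linear_combination hI / 12

/-- For real `0 < ν ≤ 1/3`, if `C(α) = 0` and `6αβ = −(α²(α²−2) + 3ν² + 1)`, then `α ≠ 0`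
and the quartic `P` has a root of multiplicity at least three. -/
theorem stmt_5 (ν : ℝ) (hν0 : 0 < ν) (hν1 : ν ≤ 1 / 3) (α β : ℂ)
    (hC : Cfun ν α = 0)
    (hβ : 6 * α * β = -(α ^ 2 * (α ^ 2 - 2) + 3 * (ν : ℂ) ^ 2 + 1)) :
    α ≠ 0 ∧ ∃ X₀ x₁ : ℂ, ∀ lam : ℂ,
      Pfun (ν : ℂ) α β lam = (lam - X₀) ^ 3 * (lam - x₁) := by
  have hα : α ≠ 0 := by
    rintro rfl
    have h : (9 * ν ^ 4 + 6 * ν ^ 2 + 1 : ℝ) = 0 := by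
      unfold Cfun at hC
      have h' : (9 * (ν : ℂ) ^ 4 + 6 * (ν : ℂ) ^ 2 + 1) = 0 := by linear_combination -hC / 3
      exact_mod_cast h'
    exact absurd h (by positivity)
  have hJ : 8 * (-α ^ 2 / 2 - 1) ^ 3 + 27 * (α - β) ^ 2 = 0 := by
    unfold Cfun at hC
    refine mul_left_cancel₀ (mul_ne_zero (by norm_num : (36 : ℂ) ≠ 0) (pow_ne_zero 2 hα)) ?_
    linear_combination -9 * hC
      + (27 * (6 * α * β - (α ^ 2 * (α ^ 2 - 2) + 3 * (ν : ℂ) ^ 2 + 1)) - 324 * α ^ 2) * hβ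
  obtain ⟨t, ht⟩ := exists_triple_root_of_depressed_quartic
    (p := -α ^ 2 / 2 - 1) (q := α - β)
    (r := (ν : ℂ) ^ 2 / 4 + α * β / 2 + α ^ 2 * (α ^ 2 - 1) / 4 - 3 * α ^ 4 / 16)
    (by linear_combination hβ) hJ
  refine ⟨hα, t - α / 2, -3 * t - α / 2, fun lam => ?_⟩
  unfold Pfun
  linear_combination ht (lam + α / 2)
end

section
/- Let ν be a real number with 0 < ν ≤ 1/3, and let ε ∈ (0, ν/2). Then there exists R > 0 such that for every α ∈ ℂ with |α| ≥ R, the quartic polynomial D(x) = 3x^4 + 4αx³ + (α² − 1)x² − ν²/4 has exactly one root x ∈ ℂ satisfying |αx − ν/2| < ε. -/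
/-- A contraction of a ball that moves the centre only slightly has a unique fixed point there. -/
lemma existsUnique_fixedPoint_ball {E : Type*} [NormedAddCommGroup E] [CompleteSpace E]
    (f : E → E) (c : E) (ε r k : ℝ) (hr : 0 ≤ r) (hrε : r < ε) (hk0 : 0 ≤ k) (hk1 : k < 1)
    (hf : ∀ y z, ‖y - c‖ < ε → ‖z - c‖ < ε → ‖f y - f z‖ ≤ k * ‖y - z‖)
    (hc : ‖f c - c‖ ≤ (1 - k) * r) :
    ∃! y, f y = y ∧ ‖y - c‖ < ε := by
  have hmaps : Set.MapsTo f (Metric.closedBall c r) (Metric.closedBall c r) := by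
    intro y hy
    rw [mem_closedBall_iff_norm] at hy ⊢
    have h1 := hf y c (by linarith) (by simpa using hr.trans_lt hrε)
    have h2 := norm_sub_le_norm_sub_add_norm_sub (f y) (f c) c
    nlinarith [mul_le_mul_of_nonneg_left hy hk0]
  have hcontr : ContractingWith ⟨k, hk0⟩ (hmaps.restrict f _ _) := by
    refine ⟨by exact_mod_cast hk1, LipschitzWith.of_dist_le_mul ?_⟩
    rintro ⟨y, hy⟩ ⟨z, hz⟩
    rw [mem_closedBall_iff_norm] at hy hz
    rw [Subtype.dist_eq, Subtype.dist_eq, dist_eq_norm, dist_eq_norm]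
    exact hf y z (by linarith) (by linarith)
  obtain ⟨y, hy, hfix, -⟩ := hcontr.exists_fixedPoint' Metric.isClosed_closedBall.isComplete hmaps
    (Metric.mem_closedBall_self hr) (edist_ne_top _ _)
  rw [mem_closedBall_iff_norm] at hy
  refine ⟨y, ⟨hfix, by linarith⟩, ?_⟩
  rintro z ⟨hz, hzε⟩
  have h := hf z y hzε (by linarith)
  rw [hz, hfix] at h
  rw [← sub_eq_zero, ← norm_le_zero_iff]
  by_contra! hpos
  nlinarith

lemma norm_sub_perturbation_le {δ y z : ℂ} {d : ℝ} (hδ : ‖δ‖ ≤ d) (hd : d ≤ 1)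
    (hy : ‖y‖ ≤ 1 / 3) (hz : ‖z‖ ≤ 1 / 3) :
    ‖(δ * (4 * y ^ 3 - y ^ 2) + 3 * δ ^ 2 * y ^ 4)
      - (δ * (4 * z ^ 3 - z ^ 2) + 3 * δ ^ 2 * z ^ 4)‖ ≤ 3 * d * ‖y - z‖ := by
  have hfac : (δ * (4 * y ^ 3 - y ^ 2) + 3 * δ ^ 2 * y ^ 4)
      - (δ * (4 * z ^ 3 - z ^ 2) + 3 * δ ^ 2 * z ^ 4)
      = δ * ((4 * (y ^ 2 + y * z + z ^ 2) - (y + z)) + 3 * δ * ((y + z) * (y ^ 2 + z ^ 2)))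
        * (y - z) := by ring
  have hsum : ‖y + z‖ ≤ 2 / 3 := (norm_add_le y z).trans (by linarith)
  have hy2 : ‖y ^ 2‖ ≤ 1 / 9 := by
    rw [norm_pow]; nlinarith [norm_nonneg y]
  have hz2 : ‖z ^ 2‖ ≤ 1 / 9 := by
    rw [norm_pow]; nlinarith [norm_nonneg z]
  have hyz : ‖y * z‖ ≤ 1 / 9 := by
    rw [norm_mul]; nlinarith [norm_nonneg y, norm_nonneg z]
  have hsq : ‖y ^ 2 + z ^ 2‖ ≤ 2 / 9 := (norm_add_le _ _).trans (by linarith)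
  have hquad : ‖4 * (y ^ 2 + y * z + z ^ 2)‖ ≤ 4 / 3 := by
    rw [norm_mul, Complex.norm_ofNat]
    linarith [norm_add₃_le (a := y ^ 2) (b := y * z) (c := z ^ 2)]
  have hcubic : ‖3 * δ * ((y + z) * (y ^ 2 + z ^ 2))‖ ≤ 4 / 9 := by
    have h : ‖y + z‖ * ‖y ^ 2 + z ^ 2‖ ≤ 2 / 3 * (2 / 9) := by gcongr
    rw [norm_mul, norm_mul, norm_mul, Complex.norm_ofNat]
    nlinarith [norm_nonneg δ, mul_nonneg (norm_nonneg (y + z)) (norm_nonneg (y ^ 2 + z ^ 2))]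
  have hbr : ‖(4 * (y ^ 2 + y * z + z ^ 2) - (y + z))
      + 3 * δ * ((y + z) * (y ^ 2 + z ^ 2))‖ ≤ 3 := by
    refine (norm_add_le _ _).trans ?_
    linarith [norm_sub_le (4 * (y ^ 2 + y * z + z ^ 2)) (y + z)]
  have hd0 : 0 ≤ d := (norm_nonneg δ).trans hδ
  rw [hfac, norm_mul, norm_mul, mul_comm 3 d]
  gcongr

/-- For small `δ`, the quartic perturbation of `y ^ 2 - c ^ 2` has a unique root near `c`. -/
lemma existsUnique_root_perturbed_square {c ε d : ℝ} (hc : c ≤ 1 / 6) (hε0 : 0 < ε) (hε : ε < c)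
    (hd1 : d ≤ 1) (hd : 6 * c * d ≤ (c - ε) * ε) {δ : ℂ} (hδ : ‖δ‖ ≤ d) :
    ∃! y : ℂ, y ^ 2 - (c : ℂ) ^ 2 + (δ * (4 * y ^ 3 - y ^ 2) + 3 * δ ^ 2 * y ^ 4) = 0 ∧
      ‖y - c‖ < ε := by
  have hc0 : 0 < c := hε0.trans hε
  have hcC : (c : ℂ) ≠ 0 := by exact_mod_cast hc0.ne'
  have hd0 : 0 ≤ d := (norm_nonneg δ).trans hδ
  have hcn : ‖(c : ℂ)‖ = c := by simp [abs_of_pos hc0]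
  have h2c : ‖2 * (c : ℂ)‖ = 2 * c := by rw [norm_mul, hcn, Complex.norm_ofNat]
  have hsmall : 6 * d < c - ε := by
    have : 6 * d * c < (c - ε) * c := by nlinarith
    exact lt_of_mul_lt_mul_right this hc0.le
  have hbound : ∀ y : ℂ, ‖y - c‖ < ε → ‖y‖ ≤ 1 / 3 := fun y hy => by
    have := norm_le_norm_sub_add y (c : ℂ)
    linarith
  set q : ℂ → ℂ := fun y => δ * (4 * y ^ 3 - y ^ 2) + 3 * δ ^ 2 * y ^ 4 with hq
  have hfix := existsUnique_fixedPoint_ball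
    (fun y : ℂ => y - (y ^ 2 - (c : ℂ) ^ 2 + q y) / (2 * c)) c ε (ε / 2) ((2 * ε + 3 * d) / (2 * c))
    (by linarith) (by linarith) (by positivity) (by rw [div_lt_one (by positivity)]; linarith)
    ?_ ?_
  · simpa only [sub_eq_self, div_eq_zero_iff, mul_eq_zero, OfNat.ofNat_ne_zero, hcC, or_self,
      or_false] using hfix
  · intro y z hy hz
    have hpert : ‖q y - q z‖ ≤ 3 * d * ‖y - z‖ :=
      norm_sub_perturbation_le hδ hd1 (hbound y hy) (hbound z hz)
    have heq : (y - (y ^ 2 - (c : ℂ) ^ 2 + q y) / (2 * c))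
        - (z - (z ^ 2 - (c : ℂ) ^ 2 + q z) / (2 * c))
        = -(((y - c) + (z - c)) * (y - z) + (q y - q z)) / (2 * c) := by
      field_simp
      ring
    have hlin : ‖((y - c) + (z - c)) * (y - z)‖ ≤ 2 * ε * ‖y - z‖ := by
      rw [norm_mul]
      gcongr
      exact (norm_add_le _ _).trans (by linarith)
    rw [heq, norm_div, norm_neg, h2c, div_mul_eq_mul_div]
    gcongr
    exact (norm_add_le _ _).trans (by linarith)
  · have hpert : ‖q c - q 0‖ ≤ 3 * d * ‖(c : ℂ) - 0‖ :=
      norm_sub_perturbation_le hδ hd1 (by rw [hcn]; linarith) (by simp)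
    have hq0 : q 0 = 0 := by simp [hq]
    rw [hq0, sub_zero, sub_zero, hcn] at hpert
    have heq : (c : ℂ) - ((c : ℂ) ^ 2 - (c : ℂ) ^ 2 + q c) / (2 * c) - c = -(q c / (2 * c)) := by
      ring
    rw [heq, norm_neg, norm_div, h2c, one_sub_div (by positivity), div_mul_eq_mul_div]
    gcongr
    nlinarith


/-- For real `0 < ν ≤ 1/3` and `0 < ε < ν/2`, there is an `R > 0` such that for every
`α ∈ ℂ` with `|α| ≥ R`, the quartic `D(x) = 3x⁴ + 4αx³ + (α²−1)x² − ν²/4` has exactly one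
root `x` with `|αx − ν/2| < ε`. -/
theorem stmt_10 (ν : ℝ) (hν0 : 0 < ν) (hν1 : ν ≤ 1 / 3)
    (ε : ℝ) (hε0 : 0 < ε) (hε1 : ε < ν / 2) :
    ∃ R > 0, ∀ α : ℂ, R ≤ ‖α‖ →
      ∃! x : ℂ,
        3 * x ^ 4 + 4 * α * x ^ 3 + (α ^ 2 - 1) * x ^ 2 - (ν : ℂ) ^ 2 / 4 = 0 ∧
        ‖α * x - (ν : ℂ) / 2‖ < ε := by
  set c : ℝ := ν / 2 with hc
  have hc0 : 0 < c := by positivity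
  have hgap : 0 < c - ε := by linarith
  set d : ℝ := (c - ε) * ε / (6 * c) with hd
  have hd0 : 0 < d := by positivity
  have hdmul : 6 * c * d = (c - ε) * ε := by
    rw [hd]
    field_simp
  have hd1 : d ≤ 1 := by
    rw [hd, div_le_one (by positivity)]
    nlinarith
  refine ⟨d⁻¹, inv_pos.mpr hd0, fun α hα => ?_⟩
  have hα0 : α ≠ 0 := norm_pos_iff.mp ((inv_pos.mpr hd0).trans_le hα)
  have hinv : ‖α⁻¹‖ ≤ d := by
    rw [norm_inv]
    exact inv_le_of_inv_le₀ hd0 hα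
  have hδ : ‖(α⁻¹) ^ 2‖ ≤ d := by
    rw [norm_pow]
    nlinarith [norm_nonneg α⁻¹]
  have hroot := existsUnique_root_perturbed_square (by linarith) hε0 hε1 hd1 hdmul.le hδ
  have hcν : (c : ℂ) = (ν : ℂ) / 2 := by simp [hc]
  have hquartic : ∀ x : ℂ, 3 * x ^ 4 + 4 * α * x ^ 3 + (α ^ 2 - 1) * x ^ 2 - (ν : ℂ) ^ 2 / 4
      = (α * x) ^ 2 - (c : ℂ) ^ 2 + ((α⁻¹) ^ 2 * (4 * (α * x) ^ 3 - (α * x) ^ 2)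
        + 3 * ((α⁻¹) ^ 2) ^ 2 * (α * x) ^ 4) := fun x => by
    rw [hcν]
    field_simp
    ring
  simp only [hquartic, ← hcν]
  exact ((Equiv.mulLeft₀ α hα0).existsUnique_congr (fun _ => Iff.rfl)).mpr hroot
end

section
/- Let ν be a real number with 0 < ν ≤ 1/3, and let α be a real number with α > 0 and C(α) > 0 (equivalently, α lies to the right of the unique positive real root v₁ of C). Then the quartic polynomial D(x) = 3x^4 + 4αx³ + (α² − 1)x² − ν²/4 has four distinct real roots, exactly one of which is positive. -/
/-- The octic polynomial `C(α)` restricted to real `α`. -/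
noncomputable def CfunR (ν α : ℝ) : ℝ :=
  α ^ 8 - 6 * (3 * ν ^ 2 + 1) * α ^ 4 + 8 * (1 - 9 * ν ^ 2) * α ^ 2
    - 3 * (9 * ν ^ 4 + 6 * ν ^ 2 + 1)

/-- A cubic vanishing at four distinct points has all its coefficients equal to zero. -/
theorem cubic_coeffs_eq_zero_of_four_roots {K : Type*} [Field K] {a b c d x₁ x₂ x₃ x₄ : K}
    (h₁₂ : x₁ ≠ x₂) (h₁₃ : x₁ ≠ x₃) (h₁₄ : x₁ ≠ x₄) (h₂₃ : x₂ ≠ x₃) (h₂₄ : x₂ ≠ x₄)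
    (h₃₄ : x₃ ≠ x₄)
    (h₁ : a * x₁ ^ 3 + b * x₁ ^ 2 + c * x₁ + d = 0)
    (h₂ : a * x₂ ^ 3 + b * x₂ ^ 2 + c * x₂ + d = 0)
    (h₃ : a * x₃ ^ 3 + b * x₃ ^ 2 + c * x₃ + d = 0)
    (h₄ : a * x₄ ^ 3 + b * x₄ ^ 2 + c * x₄ + d = 0) :
    a = 0 ∧ b = 0 ∧ c = 0 ∧ d = 0 := by
  have first : ∀ y, x₁ ≠ y → a * y ^ 3 + b * y ^ 2 + c * y + d = 0 →
      a * (x₁ ^ 2 + x₁ * y + y ^ 2) + b * (x₁ + y) + c = 0 := fun y hy h =>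
    mul_left_cancel₀ (sub_ne_zero.2 hy) (by linear_combination h₁ - h)
  have e₂ := first x₂ h₁₂ h₂
  have second : ∀ y, x₂ ≠ y → a * (x₁ ^ 2 + x₁ * y + y ^ 2) + b * (x₁ + y) + c = 0 →
      a * (x₁ + x₂ + y) + b = 0 := fun y hy h =>
    mul_left_cancel₀ (sub_ne_zero.2 hy) (by linear_combination e₂ - h)
  have f₃ := second x₃ h₂₃ (first x₃ h₁₃ h₃)
  have f₄ := second x₄ h₂₄ (first x₄ h₁₄ h₄)
  have ha : a = 0 := mul_left_cancel₀ (sub_ne_zero.2 h₃₄) (by linear_combination f₃ - f₄)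
  subst ha
  have hb : b = 0 := by linear_combination f₃
  subst hb
  have hc : c = 0 := by linear_combination e₂
  subst hc
  exact ⟨rfl, rfl, rfl, by linear_combination h₁⟩

/-- Positivity of the octic forces `α` to exceed `1`. -/
theorem one_lt_of_CfunR_pos {ν α : ℝ} (hα : 0 < α) (hC : 0 < CfunR ν α) : 1 < α := by
  by_contra! h
  have h1 : 0 ≤ 1 - α ^ 2 := by nlinarith
  have h2 : CfunR ν α = -((1 - α ^ 2) ^ 3 * (α ^ 2 + 3))
      - (18 * ν ^ 2 * α ^ 4 + 72 * ν ^ 2 * α ^ 2 + 27 * ν ^ 4 + 18 * ν ^ 2) := by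
    unfold CfunR; ring
  have h3 : 0 ≤ (1 - α ^ 2) ^ 3 * (α ^ 2 + 3) := by positivity
  have h4 : 0 ≤ 18 * ν ^ 2 * α ^ 4 + 72 * ν ^ 2 * α ^ 2 + 27 * ν ^ 4 + 18 * ν ^ 2 := by
    positivity
  linarith

/-- For real `0 < ν ≤ 1/3` and real `α > 0` with `C(α) > 0`, the quartic
`D(x) = 3x⁴ + 4αx³ + (α²−1)x² − ν²/4` has four distinct real roots, exactly one of which
is positive. -/
theorem stmt_11 (ν : ℝ) (hν0 : 0 < ν) (hν1 : ν ≤ 1 / 3)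
    (α : ℝ) (hα : 0 < α) (hC : 0 < CfunR ν α) :
    ∃ x₁ x₂ x₃ x₄ : ℝ,
      x₁ < x₂ ∧ x₂ < x₃ ∧ x₃ < x₄ ∧ x₃ < 0 ∧ 0 < x₄ ∧
      ∀ z : ℂ,
        3 * z ^ 4 + 4 * (α : ℂ) * z ^ 3 + ((α : ℂ) ^ 2 - 1) * z ^ 2 - (ν : ℂ) ^ 2 / 4 =
          3 * (z - (x₁ : ℂ)) * (z - (x₂ : ℂ)) * (z - (x₃ : ℂ)) * (z - (x₄ : ℂ)) := by
  have hα1 := one_lt_of_CfunR_pos hα hC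
  set D : ℝ → ℝ := fun x => 3 * x ^ 4 + 4 * α * x ^ 3 + (α ^ 2 - 1) * x ^ 2 - ν ^ 2 / 4 with hD
  have hcont : Continuous D := by fun_prop
  obtain ⟨s, hs0, hs⟩ : ∃ s : ℝ, 0 < s ∧ s ^ 2 = 3 * α ^ 2 + 6 :=
    ⟨√(3 * α ^ 2 + 6), by positivity, Real.sq_sqrt (by positivity)⟩
  have hs3 : s < 3 * α := by nlinarith
  -- the two negative critical points of `D`
  set p : ℝ := (-3 * α - s) / 6 with hp
  set q : ℝ := (-3 * α + s) / 6 with hq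
  have hpq : p < q := by linarith
  have hq0 : q < 0 := by linarith
  have hDp_eq : D p = -(p ^ 2 * (α * s + 3) / 6 + ν ^ 2 / 4) := by
    have hcrit : 6 * p ^ 2 + 6 * α * p + α ^ 2 - 1 = 0 := by
      rw [hp]; linear_combination hs / 6
    have : s = -3 * α - 6 * p := by rw [hp]; ring
    rw [this]
    simp only [hD]
    linear_combination p ^ 2 / 2 * hcrit
  have hDq_eq : D q = q ^ 2 * (α * s - 3) / 6 - ν ^ 2 / 4 := by
    have hcrit : 6 * q ^ 2 + 6 * α * q + α ^ 2 - 1 = 0 := by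
      rw [hq]; linear_combination hs / 6
    have : s = 3 * α + 6 * q := by rw [hq]; ring
    rw [this]
    simp only [hD]
    linear_combination q ^ 2 / 2 * hcrit
  have hDp : D p < 0 := by
    rw [hDp_eq]
    have : 0 < p ^ 2 * (α * s + 3) / 6 + ν ^ 2 / 4 := by positivity
    linarith
  have hprod : D p * D q = -(CfunR ν α) / 432 := by
    have h4 : s ^ 4 = (3 * α ^ 2 + 6) ^ 2 := by rw [← hs]; ring
    have h6 : s ^ 6 = (3 * α ^ 2 + 6) ^ 3 := by rw [← hs]; ring
    rw [hDp_eq, hDq_eq, hp, hq]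
    unfold CfunR
    ring_nf
    simp only [hs, h4, h6]
    ring
  have hDq : 0 < D q := by
    by_contra! h
    nlinarith [mul_nonneg_of_nonpos_of_nonpos hDp.le h]
  have hD0 : D 0 < 0 := by
    simp only [hD]
    nlinarith
  have hDleft : 0 < D (-3 * α) := by
    have h : D (-3 * α) = 135 * α ^ 4 + 9 * α ^ 2 * (α ^ 2 - 1) - ν ^ 2 / 4 := by
      simp only [hD]
      ring
    have hα2 : 1 < α ^ 2 := by nlinarith
    rw [h]
    nlinarith
  have hDright : 0 < D 1 := by
    simp only [hD]
    nlinarith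
  obtain ⟨x₁, ⟨-, h1p⟩, h1⟩ := intermediate_value_Ioo' (by linarith) hcont.continuousOn
    (show (0 : ℝ) ∈ Set.Ioo (D p) (D (-3 * α)) from ⟨hDp, hDleft⟩)
  obtain ⟨x₂, ⟨hp2, h2q⟩, h2⟩ := intermediate_value_Ioo hpq.le hcont.continuousOn
    (show (0 : ℝ) ∈ Set.Ioo (D p) (D q) from ⟨hDp, hDq⟩)
  obtain ⟨x₃, ⟨hq3, h30⟩, h3⟩ := intermediate_value_Ioo' hq0.le hcont.continuousOn
    (show (0 : ℝ) ∈ Set.Ioo (D 0) (D q) from ⟨hD0, hDq⟩)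
  obtain ⟨x₄, ⟨h04, -⟩, h4⟩ := intermediate_value_Ioo zero_le_one hcont.continuousOn
    (show (0 : ℝ) ∈ Set.Ioo (D 0) (D 1) from ⟨hD0, hDright⟩)
  simp only [hD] at h1 h2 h3 h4
  have h12 : x₁ < x₂ := h1p.trans hp2
  have h23 : x₂ < x₃ := h2q.trans hq3
  have h34 : x₃ < x₄ := h30.trans h04
  refine ⟨x₁, x₂, x₃, x₄, h12, h23, h34, h30, h04, fun z => ?_⟩
  obtain ⟨e3, e2, e1, e0⟩ := cubic_coeffs_eq_zero_of_four_roots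
    (a := 4 * α + 3 * (x₁ + x₂ + x₃ + x₄))
    (b := α ^ 2 - 1 - 3 * (x₁ * x₂ + x₁ * x₃ + x₁ * x₄ + x₂ * x₃ + x₂ * x₄ + x₃ * x₄))
    (c := 3 * (x₁ * x₂ * x₃ + x₁ * x₂ * x₄ + x₁ * x₃ * x₄ + x₂ * x₃ * x₄))
    (d := -ν ^ 2 / 4 - 3 * (x₁ * x₂ * x₃ * x₄))
    h12.ne (h12.trans h23).ne (h12.trans (h23.trans h34)).ne h23.ne (h23.trans h34).ne h34.ne
    (by linear_combination h1) (by linear_combination h2)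
    (by linear_combination h3) (by linear_combination h4)
  have c3 := congrArg ((↑) : ℝ → ℂ) e3
  have c2 := congrArg ((↑) : ℝ → ℂ) e2
  have c1 := congrArg ((↑) : ℝ → ℂ) e1
  have c0 := congrArg ((↑) : ℝ → ℂ) e0
  push_cast at c3 c2 c1 c0
  linear_combination z ^ 3 * c3 + z ^ 2 * c2 + z * c1 + c0
end

section
/- Let ν be a real number with 0 < ν ≤ 1/3 and let α ∈ ℂ. Then the quartic polynomial D(x) = 3x^4 + 4αx³ + (α² − 1)x² − ν²/4 has a repeated complex root (i.e., there exists x₀ ∈ ℂ such that (x − x₀)² divides D(x)) if and only if C(α) = 0. -/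
open Polynomial in
/-- The quartic polynomial `D(x) = 3x⁴ + 4αx³ + (α²−1)x² − ν²/4` as a polynomial in `x`. -/
noncomputable def Dpoly (ν : ℝ) (α : ℂ) : Polynomial ℂ :=
  C 3 * X ^ 4 + C (4 * α) * X ^ 3 + C (α ^ 2 - 1) * X ^ 2 - C ((ν : ℂ) ^ 2 / 4)

/-- Modulo `6x² + 6αx + α² − 1` the quartic `D` reduces to a linear polynomial. -/
theorem eval_Dpoly_of_critical (ν : ℝ) (α x : ℂ) (h : 6 * x ^ 2 + 6 * α * x + (α ^ 2 - 1) = 0) :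
    (Dpoly ν α).eval x =
      α * (α ^ 2 + 2) / 3 * x + ((α ^ 4 - 1) / 12 - (ν : ℂ) ^ 2 / 4) := by
  simp only [Dpoly, Polynomial.eval_sub, Polynomial.eval_add, Polynomial.eval_mul,
    Polynomial.eval_C, Polynomial.eval_pow, Polynomial.eval_X]
  linear_combination (3 * x ^ 2 + α * x - (α ^ 2 + 1) / 2) / 6 * h

/-- The product of the values of `D` at its two nonzero critical points is a multiple of `C`. -/
theorem eval_Dpoly_mul_eval_Dpoly (ν : ℝ) (α x : ℂ)
    (h : 6 * x ^ 2 + 6 * α * x + (α ^ 2 - 1) = 0) :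
    (Dpoly ν α).eval x * (Dpoly ν α).eval (-α - x) = -Cfun ν α / 432 := by
  rw [eval_Dpoly_of_critical ν α x h,
    eval_Dpoly_of_critical ν α (-α - x) (by linear_combination h), Cfun]
  linear_combination -(α * (α ^ 2 + 2) / 3) ^ 2 / 6 * h

theorem eval_derivative_Dpoly (ν : ℝ) (α x : ℂ) :
    (Polynomial.derivative (Dpoly ν α)).eval x =
      2 * x * (6 * x ^ 2 + 6 * α * x + (α ^ 2 - 1)) := by
  simp [Dpoly, Polynomial.derivative_pow]
  ring

theorem Polynomial.sq_X_sub_C_dvd_iff {K : Type*} [Field K] (p : Polynomial K) (x : K) :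
    (X - C x) ^ 2 ∣ p ↔ p.eval x = 0 ∧ (derivative p).eval x = 0 := by
  constructor
  · rintro ⟨q, rfl⟩
    simp [derivative_mul, derivative_pow]
  · rintro ⟨h, h'⟩
    obtain ⟨q, rfl⟩ := dvd_iff_isRoot.mpr h
    have hq : q.eval x = 0 := by simpa [derivative_mul] using h'
    obtain ⟨r, rfl⟩ := dvd_iff_isRoot.mpr hq
    exact ⟨r, by ring⟩

theorem exists_critical (α : ℂ) : ∃ x : ℂ, 6 * x ^ 2 + 6 * α * x + (α ^ 2 - 1) = 0 := by
  obtain ⟨w, hw⟩ := IsAlgClosed.exists_pow_nat_eq (12 * α ^ 2 + 24) (n := 2) two_pos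
  exact ⟨(-6 * α + w) / 12, by linear_combination hw / 24⟩

/-- For real `0 < ν ≤ 1/3` and `α ∈ ℂ`, the quartic `D` has a repeated complex root if and
only if `C(α) = 0`. -/
theorem stmt_12 (ν : ℝ) (hν0 : 0 < ν) (hν1 : ν ≤ 1 / 3) (α : ℂ) :
    (∃ x₀ : ℂ, (Polynomial.X - Polynomial.C x₀) ^ 2 ∣ Dpoly ν α) ↔ Cfun ν α = 0 := by
  simp only [Polynomial.sq_X_sub_C_dvd_iff, eval_derivative_Dpoly]
  constructor
  · rintro ⟨x, hx, hx'⟩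
    have hx0 : x ≠ 0 := by
      rintro rfl
      simp [Dpoly, hν0.ne'] at hx
    have hq := (mul_eq_zero.mp hx').resolve_left (mul_ne_zero two_ne_zero hx0)
    have h := eval_Dpoly_mul_eval_Dpoly ν α x hq
    rw [hx] at h
    linear_combination 432 * h
  · intro hC
    obtain ⟨x, hq⟩ := exists_critical α
    have h := eval_Dpoly_mul_eval_Dpoly ν α x hq
    rw [hC, neg_zero, zero_div, mul_eq_zero] at h
    rcases h with h | h
    · exact ⟨x, h, by rw [hq, mul_zero]⟩
    · exact ⟨-α - x, h, by linear_combination 2 * (-α - x) * hq⟩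
end

section
/- Let E > 0, let f : [0,1] → ℂ be Lebesgue integrable, and let K be a continuous complex-valued function on the closed triangle {(t, s) ∈ ℝ² : 0 ≤ s ≤ t ≤ 1} with |K(t, s)| ≤ 1 for all such (t, s). Then there exists a unique continuous function z : [0,1] → ℂ satisfying the Volterra integral equation z(t) = 1 − (1/E)·∫₀ᵗ K(t, s) f(s) z(s) ds for all t ∈ [0,1], and this solution satisfies |z(t) − 1| ≤ exp(ρ(t)/E) − 1 for all t ∈ [0,1], where ρ(t) = ∫₀ᵗ |f(s)| ds. -/
open Set MeasureTheory Filter Topology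

/-- Post-composition with a Lipschitz function preserves absolute continuity on an interval. -/
theorem AbsolutelyContinuousOnInterval.lipschitzOnWith_comp {φ g : ℝ → ℝ} {a b : ℝ} {C : NNReal}
    {S : Set ℝ} (hφ : LipschitzOnWith C φ S) (hg : AbsolutelyContinuousOnInterval g a b)
    (hS : MapsTo g (uIcc a b) S) : AbsolutelyContinuousOnInterval (fun x ↦ φ (g x)) a b := by
  refine squeeze_zero' (Eventually.of_forall fun t ↦ Finset.sum_nonneg fun i _ ↦ dist_nonneg)
    ?_ (by simpa using Tendsto.const_mul (C : ℝ) hg)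
  filter_upwards [mem_inf_of_right (mem_principal_self _)] with t ht
  rw [Finset.mul_sum]
  exact Finset.sum_le_sum fun i hi ↦
    hφ.dist_le_mul _ (hS (ht.1 i hi).1) _ (hS (ht.1 i hi).2)

/-- The change of variables `∫ h eᴿ = eᴿ - 1` for `R` the primitive of an integrable function. -/
theorem integral_mul_exp_primitive {h : ℝ → ℝ} (hh : Integrable h) (t : ℝ) :
    ∫ s in (0 : ℝ)..t, h s * Real.exp (∫ u in (0 : ℝ)..s, h u)
      = Real.exp (∫ u in (0 : ℝ)..t, h u) - 1 := by
  have hint : IntervalIntegrable h volume 0 t := hh.intervalIntegrable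
  have hac := hint.absolutelyContinuousOnInterval_intervalIntegral left_mem_uIcc
  obtain ⟨B, hB⟩ := (isCompact_uIcc.image_of_continuousOn hac.continuousOn).isBounded.subset_closedBall 0
  obtain ⟨C, hC⟩ : ∃ C, LipschitzOnWith C Real.exp (Metric.closedBall 0 B) :=
    (Real.contDiff_exp.contDiffOn (s := Metric.closedBall 0 B)).exists_lipschitzOnWith (n := 1) one_ne_zero
      (convex_closedBall _ _) (isCompact_closedBall _ _)
  have key := (hac.lipschitzOnWith_comp hC fun x hx ↦ hB (mem_image_of_mem _ hx)).integral_deriv_eq_sub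
  rw [intervalIntegral.integral_same, Real.exp_zero] at key
  rw [← key]
  refine intervalIntegral.integral_congr_ae ?_
  filter_upwards [hint.ae_hasDerivAt_integral] with x hx hxt
  rw [(hx (uIoc_subset_uIcc hxt) 0 left_mem_uIcc).exp.deriv, mul_comm]

theorem continuous_primitive_of_integrable {h : ℝ → ℝ} (hh : Integrable h) :
    Continuous fun t ↦ ∫ s in (0 : ℝ)..t, h s :=
  intervalIntegral.continuous_primitive (fun _ _ ↦ hh.intervalIntegrable) 0

/-- Integral form of Grönwall's inequality with an integrable weight. -/
theorem nonpos_of_le_integral_mul {h d : ℝ → ℝ} (hh : Integrable h) (h0 : ∀ s, 0 ≤ h s)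
    (hd : ContinuousOn d (Icc 0 1))
    (hle : ∀ t ∈ Icc (0 : ℝ) 1, d t ≤ ∫ s in (0 : ℝ)..t, h s * d s) :
    ∀ t ∈ Icc (0 : ℝ) 1, d t ≤ 0 := by
  have h2 : Integrable fun s ↦ 2 * h s := hh.const_mul 2
  set R : ℝ → ℝ := fun t ↦ ∫ s in (0 : ℝ)..t, 2 * h s
  have hRc : Continuous R := continuous_primitive_of_integrable h2
  obtain ⟨t₀, ht₀, hmax⟩ := isCompact_Icc.exists_isMaxOn (nonempty_Icc.2 zero_le_one)
    (hd.mul (Real.continuous_exp.comp hRc.neg).continuousOn)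
  set M : ℝ := d t₀ * Real.exp (-R t₀) with hM
  have hdM : ∀ s ∈ Icc (0 : ℝ) 1, d s ≤ M * Real.exp (R s) := by
    intro s hs
    have h1 : d s * Real.exp (-R s) ≤ M := hmax hs
    calc d s = d s * Real.exp (-R s) * Real.exp (R s) := by
          rw [mul_assoc, ← Real.exp_add]; simp
      _ ≤ _ := by gcongr
  have hM0 : M ≤ 0 := by
    by_contra! hpos
    have hsub : uIcc 0 t₀ ⊆ Icc (0 : ℝ) 1 := by
      rw [uIcc_of_le ht₀.1]; exact Icc_subset_Icc_right ht₀.2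
    have e1 : ∫ s in (0 : ℝ)..t₀, h s * d s ≤ ∫ s in (0 : ℝ)..t₀, M / 2 * (2 * h s * Real.exp (R s)) := by
      refine intervalIntegral.integral_mono_on ht₀.1
        (hh.intervalIntegrable.mul_continuousOn (hd.mono hsub))
        ((h2.intervalIntegrable.mul_continuousOn
          (Real.continuous_exp.comp hRc).continuousOn).const_mul _) fun s hs ↦ ?_
      have := mul_le_mul_of_nonneg_left (hdM s ⟨hs.1, hs.2.trans ht₀.2⟩) (h0 s)
      linarith
    rw [intervalIntegral.integral_const_mul, integral_mul_exp_primitive h2] at e1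
    have e2 : d t₀ = M * Real.exp (R t₀) := by
      rw [hM, mul_assoc, ← Real.exp_add]; simp
    have e3 := hle t₀ ht₀
    have e4 : 0 < M * Real.exp (R t₀) := by positivity
    change _ ≤ M / 2 * (Real.exp (R t₀) - 1) at e1
    linarith
  exact fun t ht ↦ (hdM t ht).trans (mul_nonpos_of_nonpos_of_nonneg hM0 (Real.exp_nonneg _))

section Volterra

variable {k : ℝ → ℝ → ℂ} {a : ℝ → ℂ}

theorem integrable_kernel_mul (hk : Continuous (Function.uncurry k)) (hk1 : ∀ t s, ‖k t s‖ ≤ 1)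
    (ha : Integrable a) (y : C(Icc (0 : ℝ) 1, ℂ)) (t : ℝ) :
    Integrable fun s ↦ k t s * a s * IccExtend zero_le_one y s := by
  have hkt : Continuous (k t) := hk.uncurry_left t
  have hy : Continuous (IccExtend zero_le_one y) := y.continuous.Icc_extend'
  refine Integrable.mul_bdd (c := ‖y‖) (ha.bdd_mul (c := 1) hkt.aestronglyMeasurable ?_)
    hy.aestronglyMeasurable ?_
  · exact Eventually.of_forall (hk1 t)
  · exact Eventually.of_forall fun s ↦ y.norm_coe_le_norm _

theorem continuous_integral_kernel_mul (hk : Continuous (Function.uncurry k))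
    (hk1 : ∀ t s, ‖k t s‖ ≤ 1) (ha : Integrable a) (y : C(Icc (0 : ℝ) 1, ℂ)) :
    Continuous fun t ↦ ∫ s in (0 : ℝ)..t, k t s * a s * IccExtend zero_le_one y s := by
  rw [continuous_iff_continuousAt]
  intro t
  have key := intervalIntegral.continuousAt_parametric_primitive_of_dominated (μ := volume)
    (F := fun t s ↦ k t s * a s * IccExtend zero_le_one y s)
    (fun s ↦ ‖a s‖ * ‖y‖) (-(|t| + 1)) (|t| + 1) (a₀ := 0) (b₀ := t) (x₀ := t)
    (fun x ↦ (integrable_kernel_mul hk hk1 ha y x).aestronglyMeasurable.restrict)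
    (Eventually.of_forall fun x ↦ Eventually.of_forall fun s ↦ ?_)
    (ha.norm.mul_const _).intervalIntegrable
    (Eventually.of_forall fun s ↦ ?_)
    ⟨by linarith [abs_nonneg t], by linarith [abs_nonneg t]⟩
    ⟨by linarith [neg_abs_le t], by linarith [le_abs_self t]⟩ (by simp)
  · exact key.comp (f := fun t : ℝ ↦ (t, t)) (by fun_prop)
  · rw [norm_mul, norm_mul]
    gcongr
    · exact mul_le_of_le_one_left (norm_nonneg _) (hk1 x s)
    · exact y.norm_coe_le_norm _
  · have : Continuous fun x ↦ k x s := hk.uncurry_right s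
    fun_prop

theorem norm_integral_kernel_mul_le (hk1 : ∀ t s, ‖k t s‖ ≤ 1) (ha : Integrable a)
    (y : C(Icc (0 : ℝ) 1, ℂ)) {t : ℝ} (ht : 0 ≤ t) :
    ‖∫ s in (0 : ℝ)..t, k t s * a s * IccExtend zero_le_one y s‖
      ≤ ∫ s in (0 : ℝ)..t, ‖a s‖ * ‖IccExtend zero_le_one y s‖ := by
  have hy : Continuous (IccExtend zero_le_one y) := y.continuous.Icc_extend'
  refine intervalIntegral.norm_integral_le_of_norm_le ht
    (Eventually.of_forall fun s _ ↦ ?_)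
    (ha.norm.intervalIntegrable.mul_continuousOn hy.norm.continuousOn)
  rw [norm_mul, norm_mul]
  gcongr
  exact mul_le_of_le_one_left (norm_nonneg _) (hk1 t s)

theorem integral_kernel_mul_sub (hk : Continuous (Function.uncurry k)) (hk1 : ∀ t s, ‖k t s‖ ≤ 1)
    (ha : Integrable a) (y z : C(Icc (0 : ℝ) 1, ℂ)) (t : ℝ) :
    (∫ s in (0 : ℝ)..t, k t s * a s * IccExtend zero_le_one y s)
      - ∫ s in (0 : ℝ)..t, k t s * a s * IccExtend zero_le_one z s
      = ∫ s in (0 : ℝ)..t, k t s * a s * IccExtend zero_le_one (y - z : C(Icc (0 : ℝ) 1, ℂ)) s := by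
  rw [← intervalIntegral.integral_sub (integrable_kernel_mul hk hk1 ha y t).intervalIntegrable
    (integrable_kernel_mul hk hk1 ha z t).intervalIntegrable]
  simp [IccExtend, mul_sub]

/-- A Volterra equation with bounded continuous kernel and integrable weight has a continuous
solution: the equation is a contraction for the norm weighted by `exp (2 ∫ ‖a‖)`. -/
theorem exists_volterra_solution (hk : Continuous (Function.uncurry k))
    (hk1 : ∀ t s, ‖k t s‖ ≤ 1) (ha : Integrable a) :
    ∃ y : C(Icc (0 : ℝ) 1, ℂ), ∀ t : Icc (0 : ℝ) 1,
      y t = 1 - ∫ s in (0 : ℝ)..t, k t s * a s * IccExtend zero_le_one y s := by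
  have h2 : Integrable fun s ↦ 2 * ‖a s‖ := ha.norm.const_mul 2
  set R : ℝ → ℝ := fun t ↦ ∫ s in (0 : ℝ)..t, 2 * ‖a s‖
  have hRc : Continuous R := continuous_primitive_of_integrable h2
  let W : C(Icc (0 : ℝ) 1, ℂ) := ⟨fun t ↦ (Real.exp (R t) : ℂ), by fun_prop⟩
  let W' : C(Icc (0 : ℝ) 1, ℂ) := ⟨fun t ↦ (Real.exp (-R t) : ℂ), by fun_prop⟩
  have hWW : ∀ t, W t * W' t = 1 := fun t ↦ by
    simp only [W, W', ContinuousMap.coe_mk]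
    rw [← Complex.ofReal_mul, ← Real.exp_add]; simp
  let V : C(Icc (0 : ℝ) 1, ℂ) → C(Icc (0 : ℝ) 1, ℂ) := fun y ↦
    ⟨fun t ↦ ∫ s in (0 : ℝ)..t, k t s * a s * IccExtend zero_le_one y s,
      (continuous_integral_kernel_mul hk hk1 ha y).comp continuous_subtype_val⟩
  let Φ : C(Icc (0 : ℝ) 1, ℂ) → C(Icc (0 : ℝ) 1, ℂ) := fun y ↦ W' * (1 - V (W * y))
  have hΦ : ContractingWith (1 / 2) Φ := by
    refine ⟨by norm_num [← NNReal.coe_lt_coe], LipschitzWith.of_dist_le_mul fun y z ↦ ?_⟩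
    rw [ContinuousMap.dist_le (by positivity)]
    intro t
    have hpos := Real.exp_pos (R t)
    have e0 : Φ y t - Φ z t = -W' t * ∫ s in (0 : ℝ)..t,
        k t s * a s * IccExtend zero_le_one (W * y - W * z : C(Icc (0 : ℝ) 1, ℂ)) s := by
      rw [← integral_kernel_mul_sub hk hk1 ha]
      simp only [Φ, V, ContinuousMap.mul_apply, ContinuousMap.sub_apply, ContinuousMap.one_apply,
        ContinuousMap.coe_mk]
      ring
    have e1 : ∫ s in (0 : ℝ)..t, ‖a s‖ *
        ‖IccExtend zero_le_one (W * y - W * z : C(Icc (0 : ℝ) 1, ℂ)) s‖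
        ≤ ∫ s in (0 : ℝ)..t, dist y z / 2 * (2 * ‖a s‖ * Real.exp (R s)) := by
      refine intervalIntegral.integral_mono_on t.2.1
        (ha.norm.intervalIntegrable.mul_continuousOn
          (W * y - W * z).continuous.Icc_extend'.norm.continuousOn)
        ((h2.intervalIntegrable.mul_continuousOn
          (Real.continuous_exp.comp hRc).continuousOn).const_mul _) fun s hs ↦ ?_
      have hs' : s ∈ Icc (0 : ℝ) 1 := ⟨hs.1, hs.2.trans t.2.2⟩
      rw [IccExtend_of_mem _ _ hs', ← mul_sub, ContinuousMap.mul_apply, norm_mul]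
      have n1 : ‖W ⟨s, hs'⟩‖ = Real.exp (R s) := by
        simp only [W, ContinuousMap.coe_mk, Complex.norm_real, Real.norm_eq_abs, Real.abs_exp]
      have n2 : ‖(y - z) ⟨s, hs'⟩‖ ≤ dist y z := by
        rw [dist_eq_norm]; exact (y - z).norm_coe_le_norm _
      rw [n1]
      have := mul_le_mul_of_nonneg_left n2
        (mul_nonneg (norm_nonneg (a s)) (Real.exp_nonneg (R s)))
      linarith
    rw [intervalIntegral.integral_const_mul, integral_mul_exp_primitive h2] at e1
    change _ ≤ dist y z / 2 * (Real.exp (R t) - 1) at e1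
    have n3 : ‖W' t‖ = Real.exp (-R t) := by
      simp only [W', ContinuousMap.coe_mk, Complex.norm_real, Real.norm_eq_abs, Real.abs_exp]
    rw [dist_eq_norm, e0, norm_mul, norm_neg, n3]
    calc _ ≤ Real.exp (-R t) * (dist y z / 2 * Real.exp (R t)) := by
          gcongr
          refine (norm_integral_kernel_mul_le hk1 ha _ t.2.1).trans (e1.trans ?_)
          gcongr
          linarith
      _ = dist y z / 2 * (Real.exp (-R t) * Real.exp (R t)) := by ring
      _ = ((1 / 2 : NNReal) : ℝ) * dist y z := by
          rw [← Real.exp_add]; simp; ring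
  have hfix : Φ (hΦ.fixedPoint Φ) = hΦ.fixedPoint Φ := hΦ.fixedPoint_isFixedPt
  refine ⟨W * hΦ.fixedPoint Φ, fun t ↦ ?_⟩
  conv_lhs => rw [← hfix]
  simp only [Φ, ContinuousMap.mul_apply, ← mul_assoc, hWW, one_mul]
  rfl

theorem continuousMap_eq_of_volterra (hk : Continuous (Function.uncurry k))
    (hk1 : ∀ t s, ‖k t s‖ ≤ 1) (ha : Integrable a) {y z : C(Icc (0 : ℝ) 1, ℂ)}
    (hy : ∀ t : Icc (0 : ℝ) 1,
      y t = 1 - ∫ s in (0 : ℝ)..t, k t s * a s * IccExtend zero_le_one y s)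
    (hz : ∀ t : Icc (0 : ℝ) 1,
      z t = 1 - ∫ s in (0 : ℝ)..t, k t s * a s * IccExtend zero_le_one z s) : y = z := by
  ext t
  have := nonpos_of_le_integral_mul (d := fun t ↦ ‖IccExtend zero_le_one (z - y : C(Icc (0 : ℝ) 1, ℂ)) t‖)
    ha.norm (fun s ↦ norm_nonneg _) (z - y).continuous.Icc_extend'.norm.continuousOn
    (fun t ht ↦ ?_) t t.2
  · rw [IccExtend_val, norm_le_zero_iff, ContinuousMap.sub_apply, sub_eq_zero] at this
    exact this.symm
  · rw [← norm_neg]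
    refine le_trans (le_of_eq ?_) (norm_integral_kernel_mul_le hk1 ha (z - y) ht.1)
    rw [← integral_kernel_mul_sub hk hk1 ha, IccExtend_of_mem _ _ ht, ContinuousMap.sub_apply,
      hy, hz]
    congr 1
    ring

theorem norm_volterra_solution_sub_one_le (hk1 : ∀ t s, ‖k t s‖ ≤ 1) (ha : Integrable a)
    {y : C(Icc (0 : ℝ) 1, ℂ)}
    (hy : ∀ t : Icc (0 : ℝ) 1,
      y t = 1 - ∫ s in (0 : ℝ)..t, k t s * a s * IccExtend zero_le_one y s)
    (t : Icc (0 : ℝ) 1) :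
    ‖y t - 1‖ ≤ Real.exp (∫ s in (0 : ℝ)..t, ‖a s‖) - 1 := by
  set R : ℝ → ℝ := fun t ↦ ∫ s in (0 : ℝ)..t, ‖a s‖
  have hRc : Continuous fun t ↦ Real.exp (R t) :=
    Real.continuous_exp.comp (continuous_primitive_of_integrable ha.norm)
  have hyc : Continuous fun t ↦ ‖IccExtend zero_le_one y t‖ := y.continuous.Icc_extend'.norm
  have hsub : ∀ t : Icc (0 : ℝ) 1,
      ‖y t - 1‖ ≤ ∫ s in (0 : ℝ)..t, ‖a s‖ * ‖IccExtend zero_le_one y s‖ := fun t ↦ by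
    rw [hy t, sub_sub_cancel_left, norm_neg]
    exact norm_integral_kernel_mul_le hk1 ha y t.2.1
  have hint1 : ∀ t, IntervalIntegrable (fun s ↦ ‖a s‖ * ‖IccExtend zero_le_one y s‖) volume 0 t :=
    fun t ↦ ha.norm.intervalIntegrable.mul_continuousOn hyc.continuousOn
  have hint2 : ∀ t, IntervalIntegrable (fun s ↦ ‖a s‖ * Real.exp (R s)) volume 0 t :=
    fun t ↦ ha.norm.intervalIntegrable.mul_continuousOn hRc.continuousOn
  have hgr := nonpos_of_le_integral_mul (d := fun t ↦ ‖IccExtend zero_le_one y t‖ - Real.exp (R t))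
    ha.norm (fun s ↦ norm_nonneg _) (hyc.sub hRc).continuousOn (fun t ht ↦ by
      simp only [mul_sub]
      rw [intervalIntegral.integral_sub (hint1 t) (hint2 t), integral_mul_exp_primitive ha.norm,
        IccExtend_of_mem _ _ ht]
      have h1 := hsub ⟨t, ht⟩
      have h2 := norm_le_norm_sub_add (y ⟨t, ht⟩) 1
      rw [norm_one] at h2
      change _ ≤ _ - (Real.exp (R t) - 1)
      linarith)
  rw [← integral_mul_exp_primitive ha.norm]
  refine (hsub t).trans (intervalIntegral.integral_mono_on t.2.1 (hint1 t) (hint2 t) fun s hs ↦ ?_)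
  gcongr
  exact sub_nonpos.1 (hgr s ⟨hs.1, hs.2.trans t.2.2⟩)

end Volterra

open MeasureTheory intervalIntegral in
/-- Existence, uniqueness, and the WKB error bound for the Volterra integral equation
`z(t) = 1 − (1/E) ∫₀ᵗ K(t,s) f(s) z(s) ds` on `[0,1]`, with kernel bounded by `1` in
modulus on the triangle `0 ≤ s ≤ t ≤ 1`. -/
theorem stmt_13 (E : ℝ) (hE : 0 < E) (f : ℝ → ℂ)
    (hf : MeasureTheory.IntegrableOn f (Set.Icc (0 : ℝ) 1))
    (K : ℝ → ℝ → ℂ)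
    (hKcont : ContinuousOn (fun p : ℝ × ℝ => K p.1 p.2)
      {p : ℝ × ℝ | 0 ≤ p.2 ∧ p.2 ≤ p.1 ∧ p.1 ≤ 1})
    (hKbd : ∀ t s : ℝ, 0 ≤ s → s ≤ t → t ≤ 1 → ‖K t s‖ ≤ 1) :
    ∃ z : ℝ → ℂ,
      ContinuousOn z (Set.Icc (0 : ℝ) 1) ∧
      (∀ t ∈ Set.Icc (0 : ℝ) 1,
        z t = 1 - (1 / (E : ℂ)) * ∫ s in (0 : ℝ)..t, K t s * f s * z s) ∧
      (∀ t ∈ Set.Icc (0 : ℝ) 1,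
        ‖z t - 1‖ ≤ Real.exp ((∫ s in (0 : ℝ)..t, ‖f s‖) / E) - 1) ∧
      (∀ w : ℝ → ℂ, ContinuousOn w (Set.Icc (0 : ℝ) 1) →
        (∀ t ∈ Set.Icc (0 : ℝ) 1,
          w t = 1 - (1 / (E : ℂ)) * ∫ s in (0 : ℝ)..t, K t s * f s * w s) →
        ∀ t ∈ Set.Icc (0 : ℝ) 1, w t = z t) := by
  set p : ℝ → ℝ := fun t ↦ (projIcc (0 : ℝ) 1 zero_le_one t : ℝ) with hp
  have hpc : Continuous p := continuous_subtype_val.comp continuous_projIcc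
  have hpI : ∀ t, p t ∈ Icc (0 : ℝ) 1 := fun t ↦ (projIcc (0 : ℝ) 1 zero_le_one t).2
  have hpid : ∀ t ∈ Icc (0 : ℝ) 1, p t = t := fun t ht ↦ by simp [hp, projIcc_of_mem _ ht]
  set k : ℝ → ℝ → ℂ := fun t s ↦ K (p t) (min (p s) (p t)) with hkdef
  have hk : Continuous (Function.uncurry k) := by
    refine hKcont.comp_continuous (f := fun q : ℝ × ℝ ↦ (p q.1, min (p q.2) (p q.1)))
      (by fun_prop) fun q ↦ ?_
    exact ⟨le_min (hpI _).1 (hpI _).1, min_le_right _ _, (hpI _).2⟩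
  have hk1 : ∀ t s, ‖k t s‖ ≤ 1 := fun t s ↦
    hKbd _ _ (le_min (hpI _).1 (hpI _).1) (min_le_right _ _) (hpI _).2
  set a : ℝ → ℂ := fun s ↦ 1 / (E : ℂ) * (Icc (0 : ℝ) 1).indicator f s with hadef
  have ha : Integrable a := (hf.integrable_indicator measurableSet_Icc).const_mul _
  have hvolt : ∀ w : ℝ → ℂ, ∀ y : C(Icc (0 : ℝ) 1, ℂ), (∀ t : Icc (0 : ℝ) 1, w t = y t) →
      ∀ t ∈ Icc (0 : ℝ) 1, (1 / (E : ℂ)) * ∫ s in (0 : ℝ)..t, K t s * f s * w s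
        = ∫ s in (0 : ℝ)..t, k t s * a s * IccExtend zero_le_one y s := by
    intro w y hwy t ht
    rw [← intervalIntegral.integral_const_mul]
    refine intervalIntegral.integral_congr fun s hs ↦ ?_
    rw [uIcc_of_le ht.1] at hs
    have hs' : s ∈ Icc (0 : ℝ) 1 := ⟨hs.1, hs.2.trans ht.2⟩
    simp only [hkdef, hadef]
    rw [IccExtend_of_mem _ _ hs', ← hwy, hpid t ht, hpid s hs', min_eq_left hs.2,
      indicator_of_mem hs']
    ring
  obtain ⟨y, hy⟩ := exists_volterra_solution hk hk1 ha
  refine ⟨IccExtend zero_le_one y, y.continuous.Icc_extend'.continuousOn, fun t ht ↦ ?_,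
    fun t ht ↦ ?_, fun w hw hwe t ht ↦ ?_⟩
  · rw [hvolt _ y (fun t ↦ IccExtend_val _ _ t) t ht, IccExtend_of_mem _ _ ht]
    exact hy ⟨t, ht⟩
  · rw [IccExtend_of_mem _ _ ht]
    convert norm_volterra_solution_sub_one_le hk1 ha hy ⟨t, ht⟩ using 3
    rw [← intervalIntegral.integral_div]
    refine intervalIntegral.integral_congr fun s hs ↦ ?_
    rw [uIcc_of_le ht.1] at hs
    simp only [hadef]
    rw [indicator_of_mem (show s ∈ Icc (0 : ℝ) 1 from ⟨hs.1, hs.2.trans ht.2⟩), norm_mul, norm_div, norm_one, Complex.norm_real,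
      Real.norm_of_nonneg hE.le]
    ring
  · let v : C(Icc (0 : ℝ) 1, ℂ) := ⟨(Icc (0 : ℝ) 1).domRestrict w, hw.domRestrict⟩
    have hv : v = y := continuousMap_eq_of_volterra hk hk1 ha (fun s ↦ by
      rw [← hvolt w v (fun _ ↦ rfl) s s.2]; exact hwe s s.2) hy
    rw [IccExtend_of_mem _ _ ht, ← hv]
    rfl
end

section
/- Let ν be a real number with 0 < ν ≤ 1/3 and let α, β ∈ ℂ. Define F₀(λ) = 1/(4λ²) + (−4V″(λ)V(λ) + 5V′(λ)²)/(16V(λ)²) at every λ ∈ ℂ ∖ {0} with V(λ) ≠ 0, where V′ and V″ denote the first and second complex derivatives of V. Then: (i) there exist constants C, R > 0 such that for every λ ∈ ℂ with |λ| ≥ R one has V(λ) ≠ 0 and |F₀(λ)|/|V(λ)|^{1/2} ≤ C·|λ|^{−3}; and (ii) there exist constants C′, δ > 0 such that for every λ ∈ ℂ with 0 < |λ| ≤ δ one has V(λ) ≠ 0 and |F₀(λ)|/|V(λ)|^{1/2} ≤ C′. -/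
/-- The potential `V(λ) = λ² + 2αλ + α² − 1 − β/λ + ν²/(4λ²)`. -/
noncomputable def Vfun (ν : ℝ) (α β : ℂ) : ℂ → ℂ := fun lam =>
  lam ^ 2 + 2 * α * lam + α ^ 2 - 1 - β / lam + (ν : ℂ) ^ 2 / (4 * lam ^ 2)

/-- The Langer-modified forcing term
`F₀(λ) = 1/(4λ²) + (−4V″V + 5V′²)/(16V²)`. -/
noncomputable def F0 (ν : ℝ) (α β : ℂ) : ℂ → ℂ := fun lam =>
  1 / (4 * lam ^ 2) +
    (-4 * deriv (deriv (Vfun ν α β)) lam * Vfun ν α β lam +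
      5 * (deriv (Vfun ν α β) lam) ^ 2) / (16 * (Vfun ν α β lam) ^ 2)

/-- The monic quartic `x⁴ + a x³ + b x² + c x + d`. -/
def quartic (a b c d x : ℂ) : ℂ := x ^ 4 + a * x ^ 3 + b * x ^ 2 + c * x + d

/-- The derivative of `quartic`. -/
def quarticDeriv (a b c x : ℂ) : ℂ := 4 * x ^ 3 + 3 * a * x ^ 2 + 2 * b * x + c

/-- The second derivative of `quartic`. -/
def quarticDerivTwo (a b x : ℂ) : ℂ := 12 * x ^ 2 + 6 * a * x + 2 * b

/-- With `P = quartic`, the polynomial `5 x P'² - 4 x P P'' - 4 P P'`: the numerator of `16 x P² F₀`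
when `V = P / x²`. -/
def forcingNum (a b c d x : ℂ) : ℂ :=
  5 * x * quarticDeriv a b c x ^ 2 - 4 * x * quartic a b c d x * quarticDerivTwo a b x -
    4 * quartic a b c d x * quarticDeriv a b c x

/-- The reversed polynomial `y⁴ P(1/y)` of `quartic`. -/
def quarticRev (a b c d y : ℂ) : ℂ := 1 + a * y + b * y ^ 2 + c * y ^ 3 + d * y ^ 4

/-- The reversed polynomial `y⁷ N(1/y)` of `forcingNum`. -/
def forcingNumRev (a b c d y : ℂ) : ℂ :=
  5 * (4 + 3 * a * y + 2 * b * y ^ 2 + c * y ^ 3) ^ 2 -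
    4 * quarticRev a b c d y * (12 + 6 * a * y + 2 * b * y ^ 2) -
    4 * quarticRev a b c d y * (4 + 3 * a * y + 2 * b * y ^ 2 + c * y ^ 3)

lemma Vfun_eq_quartic_div (ν : ℝ) (α β : ℂ) {x : ℂ} (hx : x ≠ 0) :
    Vfun ν α β x = quartic (2 * α) (α ^ 2 - 1) (-β) ((ν : ℂ) ^ 2 / 4) x / x ^ 2 := by
  simp only [Vfun, quartic]
  field_simp
  ring

lemma deriv_Vfun (ν : ℝ) (α β : ℂ) {x : ℂ} (hx : x ≠ 0) :
    deriv (Vfun ν α β) x = 2 * x + 2 * α + β / x ^ 2 - (ν : ℂ) ^ 2 / (2 * x ^ 3) := by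
  have h := (((((hasDerivAt_pow 2 x).add ((hasDerivAt_id x).const_mul (2 * α))).add_const
    (α ^ 2)).sub_const 1).sub ((hasDerivAt_const x β).div (hasDerivAt_id x) hx)).add
    ((hasDerivAt_const x ((ν : ℂ) ^ 2)).div ((hasDerivAt_pow 2 x).const_mul 4)
      (mul_ne_zero (by norm_num : (4 : ℂ) ≠ 0) (pow_ne_zero 2 hx)))
  refine (HasDerivAt.deriv (f := Vfun ν α β) h).trans ?_
  simp only [id]
  field_simp
  push_cast
  ring

lemma deriv_deriv_Vfun (ν : ℝ) (α β : ℂ) {x : ℂ} (hx : x ≠ 0) :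
    deriv (deriv (Vfun ν α β)) x = 2 - 2 * β / x ^ 3 + 3 * (ν : ℂ) ^ 2 / (2 * x ^ 4) := by
  have hev : deriv (Vfun ν α β) =ᶠ[nhds x]
      fun y => 2 * y + 2 * α + β / y ^ 2 - (ν : ℂ) ^ 2 / (2 * y ^ 3) :=
    (isOpen_ne.eventually_mem hx).mono fun y hy => deriv_Vfun ν α β hy
  rw [hev.deriv_eq]
  have h := ((((hasDerivAt_id x).const_mul 2).add_const (2 * α)).add
    ((hasDerivAt_const x β).div (hasDerivAt_pow 2 x) (pow_ne_zero 2 hx))).sub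
    ((hasDerivAt_const x ((ν : ℂ) ^ 2)).div ((hasDerivAt_pow 3 x).const_mul 2)
      (mul_ne_zero two_ne_zero (pow_ne_zero 3 hx)))
  refine (HasDerivAt.deriv
    (f := fun y => 2 * y + 2 * α + β / y ^ 2 - (ν : ℂ) ^ 2 / (2 * y ^ 3)) h).trans ?_
  field_simp
  push_cast
  ring

lemma F0_eq_forcingNum_div (ν : ℝ) (α β : ℂ) {x : ℂ} (hx : x ≠ 0)
    (hP : quartic (2 * α) (α ^ 2 - 1) (-β) ((ν : ℂ) ^ 2 / 4) x ≠ 0) :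
    F0 ν α β x = forcingNum (2 * α) (α ^ 2 - 1) (-β) ((ν : ℂ) ^ 2 / 4) x /
      (16 * x * quartic (2 * α) (α ^ 2 - 1) (-β) ((ν : ℂ) ^ 2 / 4) x ^ 2) := by
  have h1 : deriv (Vfun ν α β) x =
      (x * quarticDeriv (2 * α) (α ^ 2 - 1) (-β) x -
        2 * quartic (2 * α) (α ^ 2 - 1) (-β) ((ν : ℂ) ^ 2 / 4) x) / x ^ 3 := by
    rw [deriv_Vfun ν α β hx, quartic, quarticDeriv]
    field_simp
    ring
  have h2 : deriv (deriv (Vfun ν α β)) x =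
      (x ^ 2 * quarticDerivTwo (2 * α) (α ^ 2 - 1) x -
        4 * x * quarticDeriv (2 * α) (α ^ 2 - 1) (-β) x +
        6 * quartic (2 * α) (α ^ 2 - 1) (-β) ((ν : ℂ) ^ 2 / 4) x) / x ^ 4 := by
    rw [deriv_deriv_Vfun ν α β hx, quartic, quarticDeriv, quarticDerivTwo]
    field_simp
    ring
  rw [F0, h1, h2, Vfun_eq_quartic_div ν α β hx, forcingNum]
  field_simp
  ring

lemma norm_F0_div_sqrt_norm_Vfun (ν : ℝ) (α β : ℂ) {x : ℂ} (hx : x ≠ 0)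
    (hP : quartic (2 * α) (α ^ 2 - 1) (-β) ((ν : ℂ) ^ 2 / 4) x ≠ 0) :
    ‖F0 ν α β x‖ / Real.sqrt ‖Vfun ν α β x‖ =
      ‖forcingNum (2 * α) (α ^ 2 - 1) (-β) ((ν : ℂ) ^ 2 / 4) x‖ /
        (16 * ‖quartic (2 * α) (α ^ 2 - 1) (-β) ((ν : ℂ) ^ 2 / 4) x‖ ^ 2 *
          Real.sqrt ‖quartic (2 * α) (α ^ 2 - 1) (-β) ((ν : ℂ) ^ 2 / 4) x‖) := by
  rw [F0_eq_forcingNum_div ν α β hx hP, Vfun_eq_quartic_div ν α β hx]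
  have hx' : 0 < ‖x‖ := norm_pos_iff.mpr hx
  have hP' := norm_pos_iff.mpr hP
  have hs := Real.sqrt_pos.mpr hP'
  simp only [norm_div, norm_mul, norm_pow, Real.sqrt_div (norm_nonneg _),
    Real.sqrt_sq hx'.le, RCLike.norm_ofNat]
  field_simp

lemma quartic_eq_rev (a b c d : ℂ) {x : ℂ} (hx : x ≠ 0) :
    quartic a b c d x = x ^ 4 * quarticRev a b c d x⁻¹ := by
  simp only [quartic, quarticRev]
  field_simp

lemma forcingNum_eq_rev (a b c d : ℂ) {x : ℂ} (hx : x ≠ 0) :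
    forcingNum a b c d x = x ^ 7 * forcingNumRev a b c d x⁻¹ := by
  simp only [forcingNum, forcingNumRev, quartic, quarticDeriv, quarticDerivTwo, quarticRev]
  field_simp

lemma exists_norm_div_le_near_zero {f g : ℂ → ℂ} (hf : Continuous f) (hg : Continuous g)
    (hg0 : g 0 ≠ 0) :
    ∃ C > (0 : ℝ), ∃ δ > (0 : ℝ), ∀ y : ℂ, ‖y‖ ≤ δ →
      g y ≠ 0 ∧ ‖f y‖ / (16 * ‖g y‖ ^ 2 * Real.sqrt ‖g y‖) ≤ C := by
  have hpos : 0 < ‖g 0‖ := norm_pos_iff.mpr hg0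
  have hne : 16 * ‖g 0‖ ^ 2 * Real.sqrt ‖g 0‖ ≠ 0 := by positivity
  have hcont : ContinuousAt (fun y => ‖f y‖ / (16 * ‖g y‖ ^ 2 * Real.sqrt ‖g y‖)) 0 :=
    ContinuousAt.div (by fun_prop) (by fun_prop) hne
  have hev := (hg.continuousAt.eventually_ne hg0).and
    (hcont.eventually_le_const (lt_add_one _))
  obtain ⟨δ, hδ, h⟩ := Metric.nhds_basis_closedBall.eventually_iff.mp hev
  exact ⟨_, by positivity, δ, hδ, fun y hy => h (mem_closedBall_zero_iff.mpr hy)⟩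

/-- For real `0 < ν ≤ 1/3` and `α, β ∈ ℂ`:
(i) `|F₀(λ)|/|V(λ)|^{1/2} ≤ C·|λ|⁻³` for `|λ|` large (with `V(λ) ≠ 0` there), and
(ii) `|F₀(λ)|/|V(λ)|^{1/2} ≤ C′` for `|λ|` small and nonzero (with `V(λ) ≠ 0` there). -/
theorem stmt_14 (ν : ℝ) (hν0 : 0 < ν) (hν1 : ν ≤ 1 / 3) (α β : ℂ) :
    (∃ C > (0 : ℝ), ∃ R > (0 : ℝ), ∀ lam : ℂ, R ≤ ‖lam‖ →
      Vfun ν α β lam ≠ 0 ∧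
      ‖F0 ν α β lam‖ / Real.sqrt ‖Vfun ν α β lam‖ ≤ C / ‖lam‖ ^ 3) ∧
    (∃ C' > (0 : ℝ), ∃ δ > (0 : ℝ), ∀ lam : ℂ, lam ≠ 0 → ‖lam‖ ≤ δ →
      Vfun ν α β lam ≠ 0 ∧
      ‖F0 ν α β lam‖ / Real.sqrt ‖Vfun ν α β lam‖ ≤ C') := by
  constructor
  · obtain ⟨C, hC, δ, hδ, h⟩ := exists_norm_div_le_near_zero
      (f := forcingNumRev (2 * α) (α ^ 2 - 1) (-β) ((ν : ℂ) ^ 2 / 4))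
      (g := quarticRev (2 * α) (α ^ 2 - 1) (-β) ((ν : ℂ) ^ 2 / 4))
      (by unfold forcingNumRev quarticRev; fun_prop) (by unfold quarticRev; fun_prop)
      (by simp [quarticRev])
    refine ⟨C, hC, δ⁻¹, inv_pos.mpr hδ, fun x hxR => ?_⟩
    have hx' : 0 < ‖x‖ := (inv_pos.mpr hδ).trans_le hxR
    have hx : x ≠ 0 := norm_pos_iff.mp hx'
    obtain ⟨hQ, hle⟩ := h x⁻¹ (by rw [norm_inv]; exact inv_le_of_inv_le₀ hδ hxR)
    have hP : quartic (2 * α) (α ^ 2 - 1) (-β) ((ν : ℂ) ^ 2 / 4) x ≠ 0 := by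
      rw [quartic_eq_rev _ _ _ _ hx]
      exact mul_ne_zero (pow_ne_zero 4 hx) hQ
    refine ⟨by rw [Vfun_eq_quartic_div ν α β hx]; exact div_ne_zero hP (pow_ne_zero 2 hx), ?_⟩
    rw [norm_F0_div_sqrt_norm_Vfun ν α β hx hP, quartic_eq_rev _ _ _ _ hx,
      forcingNum_eq_rev _ _ _ _ hx]
    refine le_of_eq_of_le ?_ (div_le_div_of_nonneg_right hle (pow_pos hx' 3).le)
    have hQ' := norm_pos_iff.mpr hQ
    have hs := Real.sqrt_pos.mpr hQ'
    have hsq : Real.sqrt (‖x‖ ^ 4) = ‖x‖ ^ 2 := by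
      rw [show ‖x‖ ^ 4 = (‖x‖ ^ 2) ^ 2 by ring, Real.sqrt_sq (by positivity)]
    simp only [norm_mul, norm_pow, Real.sqrt_mul (pow_nonneg (norm_nonneg x) 4), hsq]
    field_simp
  · obtain ⟨C, hC, δ, hδ, h⟩ := exists_norm_div_le_near_zero
      (f := forcingNum (2 * α) (α ^ 2 - 1) (-β) ((ν : ℂ) ^ 2 / 4))
      (g := quartic (2 * α) (α ^ 2 - 1) (-β) ((ν : ℂ) ^ 2 / 4))
      (by unfold forcingNum quartic quarticDeriv quarticDerivTwo; fun_prop)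
      (by unfold quartic; fun_prop) (by simp [quartic, hν0.ne'])
    refine ⟨C, hC, δ, hδ, fun x hx hxδ => ?_⟩
    obtain ⟨hP, hle⟩ := h x hxδ
    refine ⟨by rw [Vfun_eq_quartic_div ν α β hx]; exact div_ne_zero hP (pow_ne_zero 2 hx), ?_⟩
    rwa [norm_F0_div_sqrt_norm_Vfun ν α β hx hP]
end
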